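/- arXiv:1611.00858 — 3 statements merged into one kernel-verified Lean document; each statement's English description precedes it below -/
import Mathlib

section
/- Let V and W be real Banach spaces with V nontrivial, let n ∈ ℕ, let f : V → W be n-times continuously Fréchet differentiable, and let g : V → L^{(n+1)}(V,W) be a continuous map into the space of continuous (n+1)-multilinear maps from V to W. Assume that for every x ∈ V and every u₁,…,uₙ ∈ V one has lim_{V∖{0} ∋ h → 0} ‖f^{(n)}(x+h)(u₁,…,uₙ) − f^{(n)}(x)(u₁,…,uₙ) − g(x)(u₁,…,uₙ,h)‖_W / ‖h‖_V = 0. Then f is (n+1)-times continuously Fréchet differentiable and f^{(n+1)} = g. -/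
open Filter Topology

theorem Continuous.exists_ball_norm_sub_le
    {X G : Type*} [PseudoMetricSpace X] [SeminormedAddCommGroup G] {A : X → G}
    (hA : Continuous A) (x : X) {c : ℝ} (hc : 0 < c) :
    ∃ r > 0, ∀ y ∈ Metric.ball x r, ‖A y - A x‖ ≤ c := by
  obtain ⟨r, hr, hball⟩ := Metric.continuousAt_iff.1 hA.continuousAt c hc
  exact ⟨r, hr, fun y hy => (dist_eq_norm (A y) (A x)).symm.trans_le (hball hy).le⟩

/-- A map into continuous multilinear maps whose evaluations are all Fréchet differentiable, with
derivatives given by a continuous operator-valued map, is itself Fréchet differentiable. -/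
theorem ContinuousMultilinearMap.hasFDerivAt_of_apply
    {ι V W : Type*} {E : ι → Type*} [Fintype ι]
    [NormedAddCommGroup V] [NormedSpace ℝ V]
    [∀ i, NormedAddCommGroup (E i)] [∀ i, NormedSpace ℝ (E i)]
    [NormedAddCommGroup W] [NormedSpace ℝ W]
    {F : V → ContinuousMultilinearMap ℝ E W}
    {A : V → V →L[ℝ] ContinuousMultilinearMap ℝ E W} (hA : Continuous A)
    (hF : ∀ x u, HasFDerivAt (fun y => F y u)
      ((ContinuousMultilinearMap.apply ℝ E W u).comp (A x)) x) (x : V) :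
    HasFDerivAt F (A x) x := by
  rw [hasFDerivAt_iff_isLittleO_nhds_zero, Asymptotics.isLittleO_iff]
  intro c hc
  obtain ⟨r, hr, hball⟩ := Continuous.exists_ball_norm_sub_le
    (G := V →L[ℝ] ContinuousMultilinearMap ℝ E W) hA x hc
  filter_upwards [Metric.ball_mem_nhds (0 : V) hr] with h hh
  refine ContinuousMultilinearMap.opNorm_le_bound (by positivity) fun u => ?_
  have bound : ∀ y ∈ Metric.ball x r,
      ‖(ContinuousMultilinearMap.apply ℝ E W u).comp (A y)
        - (ContinuousMultilinearMap.apply ℝ E W u).comp (A x)‖ ≤ c * ∏ i, ‖u i‖ := by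
    intro y hy
    have hAy : ‖A y - A x‖ ≤ c := hball y hy
    refine ContinuousLinearMap.opNorm_le_bound _ (by positivity) fun v => ?_
    calc ‖(A y - A x) v u‖ ≤ ‖(A y - A x) v‖ * ∏ i, ‖u i‖ :=
          ContinuousMultilinearMap.le_opNorm _ _
      _ ≤ (c * ‖v‖) * ∏ i, ‖u i‖ := by
          gcongr
          exact (A y - A x).le_of_opNorm_le hAy v
      _ = c * (∏ i, ‖u i‖) * ‖v‖ := by ring
  have hmem : x + h ∈ Metric.ball x r := by simpa using hh
  have key := (convex_ball x r).norm_image_sub_le_of_norm_hasFDerivWithin_le'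
    (fun y _ => (hF y u).hasFDerivWithinAt) bound (Metric.mem_ball_self hr) hmem
  rw [add_sub_cancel_left] at key
  calc ‖(F (x + h) - F x - A x h) u‖ ≤ c * (∏ i, ‖u i‖) * ‖h‖ := key
    _ = c * ‖h‖ * ∏ i, ‖u i‖ := by ring

/-- In the iterated derivative of a sufficiently smooth function over `ℝ`, the last direction
can be moved to the front. -/
theorem ContDiff.iteratedFDeriv_succ_snoc
    {V W : Type*} [NormedAddCommGroup V] [NormedSpace ℝ V]
    [NormedAddCommGroup W] [NormedSpace ℝ W] {f : V → W} :
    ∀ {n : ℕ}, ContDiff ℝ (n + 1) f → ∀ (x : V) (u : Fin n → V) (h : V),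
      iteratedFDeriv ℝ (n + 1) f x (Fin.snoc u h : Fin (n + 1) → V)
        = iteratedFDeriv ℝ (n + 1) f x (Fin.cons h u : Fin (n + 1) → V)
  | 0, _, x, u, h => by
    congr 1
    ext i
    obtain rfl : i = 0 := Fin.fin_one_eq_zero i
    rfl
  | n + 1, hf, x, u, h => by
    have hcons : ∀ {k : ℕ}, k < n + 2 → ∀ (y a : V) (v : Fin k → V),
        iteratedFDeriv ℝ (k + 1) f y (Fin.cons a v : Fin (k + 1) → V)
          = fderiv ℝ (fun z => iteratedFDeriv ℝ k f z v) y a := by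
      intro k hk y a v
      have hd : DifferentiableAt ℝ (iteratedFDeriv ℝ k f) y :=
        hf.differentiable_iteratedFDeriv (by exact_mod_cast hk) y
      rw [hd.iteratedFDeriv_succ_apply_left', Fin.tail_cons, Fin.cons_zero]
    obtain ⟨a, v, rfl⟩ : ∃ (a : V) (v : Fin n → V), u = (Fin.cons a v : Fin (n + 1) → V) :=
      ⟨u 0, Fin.tail u, (Fin.cons_self_tail u).symm⟩
    have hf' : ContDiff ℝ (n + 1) f := hf.of_le (by exact_mod_cast Nat.le_succ _)
    have hφ : ContDiff ℝ 2 (fun z => iteratedFDeriv ℝ n f z v) :=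
      (ContinuousMultilinearMap.apply ℝ (fun _ : Fin n => V) W v).contDiff.comp
        (hf.iteratedFDeriv_right (m := 2) (by norm_cast; omega))
    have hsymm : IsSymmSndFDerivAt ℝ (fun z => iteratedFDeriv ℝ n f z v) x :=
      hφ.contDiffAt.isSymmSndFDerivAt (by simp)
    have hdiff : DifferentiableAt ℝ (fderiv ℝ (fun z => iteratedFDeriv ℝ n f z v)) x :=
      (hφ.fderiv_right (m := 1) (by norm_num)).differentiable (by norm_num) x
    have happly : ∀ b c : V,
        fderiv ℝ (fun y => fderiv ℝ (fun z => iteratedFDeriv ℝ n f z v) y b) x c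
          = fderiv ℝ (fderiv ℝ (fun z => iteratedFDeriv ℝ n f z v)) x c b := by
      intro b c
      rw [fderiv_clm_apply hdiff (differentiableAt_const b)]
      simp
    rw [← Fin.cons_snoc_eq_snoc_cons, hcons (by omega), hcons (by omega)]
    simp only [ContDiff.iteratedFDeriv_succ_snoc hf', hcons (show n < n + 2 by omega), happly]
    exact hsymm.eq a h

/-- pointwise differentiation, Lemma 2.2 of the paper.
If `f : V → W` is `n`-times continuously Fréchet differentiable, `g` is a continuous map
into the continuous `(n+1)`-multilinear maps, and for all `x` and all directions
`u₁, …, uₙ` the difference quotient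
`‖f⁽ⁿ⁾(x+h)u - f⁽ⁿ⁾(x)u - g(x)(u,h)‖ / ‖h‖` tends to `0` as `h → 0`, `h ≠ 0`,
then `f` is `(n+1)`-times continuously Fréchet differentiable with `f⁽ⁿ⁺¹⁾ = g`. -/
theorem stmt_0
    {V W : Type*}
    [NormedAddCommGroup V] [NormedSpace ℝ V] [CompleteSpace V] [Nontrivial V]
    [NormedAddCommGroup W] [NormedSpace ℝ W] [CompleteSpace W]
    (n : ℕ) (f : V → W) (hf : ContDiff ℝ n f)
    (g : V → ContinuousMultilinearMap ℝ (fun _ : Fin (n + 1) => V) W)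
    (hg : Continuous g)
    (hlim : ∀ (x : V) (u : Fin n → V),
      Tendsto
        (fun h : V =>
          ‖iteratedFDeriv ℝ n f (x + h) u - iteratedFDeriv ℝ n f x u
            - g x (Fin.snoc u h)‖ / ‖h‖)
        (nhdsWithin (0 : V) {(0 : V)}ᶜ) (nhds (0 : ℝ))) :
    ContDiff ℝ (n + 1) f ∧ iteratedFDeriv ℝ (n + 1) f = g := by
  let A : V → V →L[ℝ] ContinuousMultilinearMap ℝ (fun _ : Fin n => V) W := fun x =>
    ContinuousMultilinearMap.curryMidEquiv ℝ (fun _ : Fin (n + 1) => V) W (Fin.last n) (g x)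
  have hA : Continuous A := (LinearIsometryEquiv.continuous _).comp hg
  have hA_apply : ∀ x h u, A x h u = g x (Fin.snoc u h) := fun x h u =>
    congrArg (g x) (Fin.insertNth_last' h u)
  have hF : ∀ x, HasFDerivAt (iteratedFDeriv ℝ n f) (A x) x := by
    refine ContinuousMultilinearMap.hasFDerivAt_of_apply hA fun x u => ?_
    rw [hasFDerivAt_iff_isLittleO_nhds_zero, ← Asymptotics.isLittleO_norm_left,
      ← Asymptotics.isLittleO_norm_right, Asymptotics.isLittleO_iff_tendsto (by simp +contextual)]
    rw [← nhdsNE_sup_pure, tendsto_sup]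
    refine ⟨(hlim x u).congr fun h => ?_, ?_⟩
    · simp [hA_apply]
    · rw [tendsto_pure_left]
      intro s hs
      simpa using mem_of_mem_nhds hs
  have hcont : ContDiff ℝ (n + 1) f := by
    have hfderiv : fderiv ℝ (iteratedFDeriv ℝ n f) = A := funext fun x => (hF x).fderiv
    have hf' := contDiff_nat_iff_continuous_differentiable.1 hf
    refine (contDiff_nat_iff_continuous_differentiable (n := n + 1)).2
      ⟨fun m hm => ?_, fun m hm => ?_⟩
    · rcases hm.lt_or_eq with hm | rfl
      · exact hf'.1 m (Nat.lt_succ_iff.1 hm)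
      · rw [iteratedFDeriv_succ_eq_comp_left, hfderiv]
        exact (LinearIsometryEquiv.continuous _).comp hA
    · rcases (Nat.lt_succ_iff.1 hm).lt_or_eq with hm | rfl
      · exact hf'.2 m hm
      · exact fun x => (hF x).differentiableAt
  refine ⟨hcont, ?_⟩
  ext x m
  rw [← Fin.snoc_init_self m, hcont.iteratedFDeriv_succ_snoc, iteratedFDeriv_succ_apply_left,
    (hF x).fderiv, Fin.cons_zero, Fin.tail_cons, hA_apply]
end

section
/- Let H be a real Hilbert space with H ≠ {0}, let V be a real Banach space, let m ∈ ℕ, let φ ∈ C_b^{m+1}(H,V), and let Φ_m : H^{m+1} → V be defined by Φ_m(u₁,…,u_{m+1}) = φ^{(m)}(u_{m+1})(u₁,…,u_m), where H^{m+1} carries the norm ‖(u₁,…,u_{m+1})‖_{H^{m+1}} = (Σ_{i=1}^{m+1} ‖u_i‖_H²)^{1/2}. Then Φ_m is continuously Fréchet differentiable and for every u ∈ H^{m+1} it holds that ‖Φ_m'(u)‖_{L(H^{m+1},V)} ≤ √(m+1) · ‖φ‖_{C_b^{m+1}(H,V)} · max{1, ‖u‖_{H^{m+1}}}^m. -/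
open scoped ENNReal

theorem ContDiff.continuousMultilinearMap_apply_apply {𝕜 ι G F : Type*} {E : ι → Type*}
    [NontriviallyNormedField 𝕜] [Fintype ι]
    [NormedAddCommGroup G] [NormedSpace 𝕜 G]
    [NormedAddCommGroup F] [NormedSpace 𝕜 F] [CompleteSpace F]
    [∀ i, NormedAddCommGroup (E i)] [∀ i, NormedSpace 𝕜 (E i)] {n : WithTop ℕ∞}
    {f : G → ContinuousMultilinearMap 𝕜 E F} {g : ∀ i, G → E i}
    (hf : ContDiff 𝕜 n f) (hg : ∀ i, ContDiff 𝕜 n (g i)) :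
    ContDiff 𝕜 n (fun x ↦ f x (g · x)) := by
  have h : ContDiff 𝕜 n
      (fun p : ContinuousMultilinearMap 𝕜 E F × (∀ i, E i) ↦ p.1 p.2) :=
    contDiff_iff_contDiffAt.2 fun _ ↦
      (ContinuousLinearMap.id 𝕜
        (ContinuousMultilinearMap 𝕜 E F)).cpolynomialAt_uncurry_of_multilinear.contDiffAt
  exact h.comp (hf.prodMk (contDiff_pi.2 hg))

theorem PiLp.sum_norm_le_sqrt_card_mul_norm {ι : Type*} [Fintype ι] {β : ι → Type*}
    [∀ i, SeminormedAddCommGroup (β i)] (v : PiLp 2 β) :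
    ∑ i, ‖v i‖ ≤ √(Fintype.card ι) * ‖v‖ := by
  refine le_of_sq_le_sq ?_ (by positivity)
  rw [mul_pow, Real.sq_sqrt (Nat.cast_nonneg _), PiLp.norm_sq_eq_of_L2]
  exact sq_sum_le_card_mul_sum_sq

theorem ContinuousMultilinearMap.norm_apply_update_le {𝕜 ι F : Type*} {E : ι → Type*}
    [NontriviallyNormedField 𝕜] [Fintype ι] [DecidableEq ι]
    [SeminormedAddCommGroup F] [NormedSpace 𝕜 F]
    [∀ i, SeminormedAddCommGroup (E i)] [∀ i, NormedSpace 𝕜 (E i)]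
    (f : ContinuousMultilinearMap 𝕜 E F) {x : ∀ i, E i} {M : ℝ} (hM : 1 ≤ M)
    (hx : ∀ i, ‖x i‖ ≤ M) (i : ι) (y : E i) :
    ‖f (Function.update x i y)‖ ≤ ‖f‖ * M ^ Fintype.card ι * ‖y‖ := by
  refine (f.le_opNorm _).trans ?_
  rw [mul_assoc]
  gcongr
  rw [← Finset.mul_prod_erase _ _ (Finset.mem_univ i), Function.update_self, mul_comm]
  gcongr
  calc ∏ j ∈ Finset.univ.erase i, ‖Function.update x i y j‖
      ≤ ∏ _j ∈ Finset.univ.erase i, M := by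
        refine Finset.prod_le_prod (fun _ _ ↦ norm_nonneg _) fun j hj ↦ ?_
        rw [Function.update_of_ne (Finset.ne_of_mem_erase hj)]
        exact hx j
    _ ≤ M ^ Fintype.card ι := by
        rw [Finset.prod_const]
        exact pow_le_pow_right₀ hM (Finset.card_le_univ _)

/-- For `φ ∈ C_b^{m+1}(H,V)` the map
`Φ_m(u₁,…,u_{m+1}) = φ⁽ᵐ⁾(u_{m+1})(u₁,…,u_m)` on `H^{m+1}` (with the ℓ²-product norm,
realized as `PiLp 2`) is continuously Fréchet differentiable and
`‖Φ_m'(u)‖ ≤ √(m+1) · ‖φ‖_{C_b^{m+1}} · max{1,‖u‖}^m`, where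
`‖φ‖_{C_b^{m+1}} = ‖φ(0)‖ + ∑_{k=1}^{m+1} sup_x ‖φ⁽ᵏ⁾(x)‖`. -/
theorem stmt_8
    {H V : Type*}
    [NormedAddCommGroup H] [InnerProductSpace ℝ H] [CompleteSpace H] [Nontrivial H]
    [NormedAddCommGroup V] [NormedSpace ℝ V] [CompleteSpace V]
    (m : ℕ) (hm : 1 ≤ m) (φ : H → V) (hφ : ContDiff ℝ (m + 1) φ)
    (hbdd : ∀ k : ℕ, 1 ≤ k → k ≤ m + 1 →
      ∃ C : ℝ, ∀ x : H, ‖iteratedFDeriv ℝ k φ x‖ ≤ C)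
    (Φ : PiLp 2 (fun _ : Fin (m + 1) => H) → V)
    (hΦ : ∀ u : PiLp 2 (fun _ : Fin (m + 1) => H),
      Φ u = iteratedFDeriv ℝ m φ (u (Fin.last m)) (fun i : Fin m => u (Fin.castSucc i))) :
    ContDiff ℝ 1 Φ ∧
      ∀ u : PiLp 2 (fun _ : Fin (m + 1) => H),
        ‖fderiv ℝ Φ u‖ ≤
          Real.sqrt (m + 1) *
            (‖φ 0‖ + ∑ k ∈ Finset.Icc 1 (m + 1), ⨆ x : H, ‖iteratedFDeriv ℝ k φ x‖) *
            (max 1 ‖u‖) ^ m := by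
  have hsmooth : ContDiff ℝ 1 (iteratedFDeriv ℝ m φ) :=
    hφ.iteratedFDeriv_right (by rw [add_comm])
  obtain rfl : Φ = fun u ↦
      iteratedFDeriv ℝ m φ (u (Fin.last m)) (fun i : Fin m => u (Fin.castSucc i)) := funext hΦ
  have hcoord (i : Fin (m + 1)) :
      ContDiff ℝ 1 fun u : PiLp 2 (fun _ : Fin (m + 1) => H) ↦ u i := contDiff_piLp_apply 2
  refine ⟨(hsmooth.comp (hcoord _)).continuousMultilinearMap_apply_apply
    fun i ↦ hcoord (Fin.castSucc i), fun u ↦ ?_⟩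
  set M := max 1 ‖u‖
  set S := fun k : ℕ ↦ ⨆ x : H, ‖iteratedFDeriv ℝ k φ x‖
  have hM : 1 ≤ M := le_max_left _ _
  have hu (i : Fin (m + 1)) : ‖u i‖ ≤ M := (PiLp.norm_apply_le u i).trans (le_max_right _ _)
  have hS (k : ℕ) (hk : 1 ≤ k) (hk' : k ≤ m + 1) (x : H) : ‖iteratedFDeriv ℝ k φ x‖ ≤ S k := by
    obtain ⟨C, hC⟩ := hbdd k hk hk'
    exact le_ciSup (f := fun x ↦ ‖iteratedFDeriv ℝ k φ x‖) ⟨C, by rintro _ ⟨y, rfl⟩; exact hC y⟩ x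
  have hS_nonneg (k : ℕ) : 0 ≤ S k := Real.iSup_nonneg fun _ ↦ norm_nonneg _
  set N := ‖φ 0‖ + ∑ k ∈ Finset.Icc 1 (m + 1), S k
  have hN (k : ℕ) (hk : 1 ≤ k) (hk' : k ≤ m + 1) : S k ≤ N :=
    (Finset.single_le_sum (fun k _ ↦ hS_nonneg k) (Finset.mem_Icc.2 ⟨hk, hk'⟩)).trans
      (le_add_of_nonneg_left (norm_nonneg _))
  have hN_nonneg : 0 ≤ N := (hS_nonneg 1).trans (hN 1 le_rfl (by omega))
  have hbase : HasFDerivAt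
      (fun w : PiLp 2 (fun _ : Fin (m + 1) => H) ↦ iteratedFDeriv ℝ m φ (w (Fin.last m)))
      (fderiv ℝ (iteratedFDeriv ℝ m φ) (u (Fin.last m)) ∘L
        PiLp.proj 2 (fun _ : Fin (m + 1) => H) (Fin.last m)) u :=
    (hsmooth.differentiable one_ne_zero (u (Fin.last m))).hasFDerivAt.comp u
      (PiLp.hasFDerivAt_apply 2 u (Fin.last m))
  have hderiv := hbase.continuousMultilinearMap_apply
    fun i : Fin m ↦ PiLp.hasFDerivAt_apply (𝕜 := ℝ) 2 u (Fin.castSucc i)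
  rw [hderiv.fderiv]
  refine ContinuousLinearMap.opNorm_le_bound _ (by positivity) fun v ↦ ?_
  have hlast : ‖fderiv ℝ (iteratedFDeriv ℝ m φ) (u (Fin.last m)) (v (Fin.last m))
      (fun i : Fin m ↦ u (Fin.castSucc i))‖ ≤ N * M ^ m * ‖v (Fin.last m)‖ := by
    calc _ ≤ ‖fderiv ℝ (iteratedFDeriv ℝ m φ) (u (Fin.last m)) (v (Fin.last m))‖ * M ^ m := by
            simpa using ContinuousMultilinearMap.le_opNorm_mul_pow_of_le _
              ((pi_norm_le_iff_of_nonneg (by positivity)).2 fun i : Fin m ↦ hu (Fin.castSucc i))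
      _ ≤ (N * ‖v (Fin.last m)‖) * M ^ m := by
            gcongr
            refine (ContinuousLinearMap.le_opNorm _ _).trans ?_
            gcongr
            rw [norm_fderiv_iteratedFDeriv]
            exact (hS (m + 1) (by omega) le_rfl _).trans (hN (m + 1) (by omega) le_rfl)
      _ = _ := by ring
  have hcast (i : Fin m) : ‖iteratedFDeriv ℝ m φ (u (Fin.last m))
      (Function.update (fun j : Fin m ↦ u (Fin.castSucc j)) i (v (Fin.castSucc i)))‖
      ≤ N * M ^ m * ‖v (Fin.castSucc i)‖ := by
    refine (ContinuousMultilinearMap.norm_apply_update_le _ hM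
      (fun j : Fin m ↦ hu (Fin.castSucc j)) i _).trans ?_
    rw [Fintype.card_fin]
    gcongr
    exact (hS m hm (by omega) _).trans (hN m hm (by omega))
  calc _ ≤ N * M ^ m * ‖v (Fin.last m)‖ + ∑ i : Fin m, N * M ^ m * ‖v (Fin.castSucc i)‖ := by
          simp only [add_apply, sum_apply,
            ContinuousLinearMap.comp_apply]
          refine (norm_add_le _ _).trans (add_le_add hlast ?_)
          exact (norm_sum_le _ _).trans (Finset.sum_le_sum fun i _ ↦ hcast i)
    _ = N * M ^ m * ∑ i, ‖v i‖ := by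
          rw [Fin.sum_univ_castSucc, ← Finset.mul_sum]
          ring
    _ ≤ N * M ^ m * (√(m + 1) * ‖v‖) := by
          gcongr
          simpa using PiLp.sum_norm_le_sqrt_card_mul_norm v
    _ = _ := by ring
end

section
/- Let V and W be real Banach spaces with V nontrivial, let n ∈ ℕ, let f : V → W be n-times continuously Fréchet differentiable, and let g : V → L^{(n+1)}(V,W) be continuous such that for every x ∈ V and every u₁,…,uₙ ∈ V one has lim_{V∖{0} ∋ h → 0} ‖f^{(n)}(x+h)(u₁,…,uₙ) − f^{(n)}(x)(u₁,…,uₙ) − g(x)(u₁,…,uₙ,h)‖_W / ‖h‖_V = 0. Then for every x ∈ V the convergence is uniform over directions: lim_{V∖{0} ∋ h → 0} sup_{u₁,…,uₙ ∈ V∖{0}} [ ‖f^{(n)}(x+h)(u₁,…,uₙ) − f^{(n)}(x)(u₁,…,uₙ) − g(x)(u₁,…,uₙ,h)‖_W / ( ‖h‖_V · Π_{i=1}^n ‖u_i‖_V ) ] = 0. -/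
open Filter Topology

/-- Under the hypotheses of the pointwise differentiation lemma,
the convergence of the difference quotients is uniform over the directions
`u₁, …, uₙ ∈ V ∖ {0}`: for every `x` and every `ε > 0`, eventually for `h → 0`, `h ≠ 0`,
the normalized remainder is `≤ ε` simultaneously for all nonzero directions. -/
theorem stmt_15
    {V W : Type*}
    [NormedAddCommGroup V] [NormedSpace ℝ V] [CompleteSpace V] [Nontrivial V]
    [NormedAddCommGroup W] [NormedSpace ℝ W] [CompleteSpace W]
    (n : ℕ) (f : V → W) (hf : ContDiff ℝ n f)
    (g : V → ContinuousMultilinearMap ℝ (fun _ : Fin (n + 1) => V) W)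
    (hg : Continuous g)
    (hlim : ∀ (x : V) (u : Fin n → V),
      Tendsto
        (fun h : V =>
          ‖iteratedFDeriv ℝ n f (x + h) u - iteratedFDeriv ℝ n f x u
            - g x (Fin.snoc u h)‖ / ‖h‖)
        (nhdsWithin (0 : V) {(0 : V)}ᶜ) (nhds (0 : ℝ))) :
    ∀ (x : V) (ε : ℝ), 0 < ε →
      ∀ᶠ h in nhdsWithin (0 : V) {(0 : V)}ᶜ,
        ∀ u : Fin n → V, (∀ i, u i ≠ 0) →
          ‖iteratedFDeriv ℝ n f (x + h) u - iteratedFDeriv ℝ n f x u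
              - g x (Fin.snoc u h)‖ / (‖h‖ * ∏ i, ‖u i‖) ≤ ε := by
  intro x ε hε
  have hderiv : ∀ (u : Fin n → V) (y : V),
      HasFDerivAt (fun z => iteratedFDeriv ℝ n f z u) ((g y).curryRight u) y := by
    intro u y
    rw [hasFDerivAt_iff_isLittleO_nhds_zero, Asymptotics.isLittleO_iff]
    intro c hc
    have hev := (hlim y u).eventually (gt_mem_nhds hc)
    rw [eventually_nhdsWithin_iff] at hev
    filter_upwards [hev] with h hh
    rcases eq_or_ne h 0 with rfl | h0
    · simp only [add_zero, sub_self, map_zero, norm_zero, mul_zero, le_refl]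
    · exact ((div_lt_iff₀ (norm_pos_iff.mpr h0)).mp (hh h0)).le
  obtain ⟨δ, hδ, hgδ⟩ := Metric.continuous_iff.mp hg x ε hε
  filter_upwards [mem_nhdsWithin_of_mem_nhds (Metric.ball_mem_nhds (0 : V) hδ),
    self_mem_nhdsWithin] with h hh h0 u hu
  have hpos : 0 < ‖h‖ * ∏ i, ‖u i‖ :=
    mul_pos (norm_pos_iff.mpr h0) (Finset.prod_pos fun i _ => norm_pos_iff.mpr (hu i))
  rw [div_le_iff₀ hpos]
  have hbound : ∀ y ∈ Metric.ball x δ,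
      ‖(g y).curryRight u - (g x).curryRight u‖ ≤ ε * ∏ i, ‖u i‖ := by
    intro y hy
    have hgy : ‖g y - g x‖ ≤ ε := by
      rw [← dist_eq_norm]
      exact (hgδ y hy).le
    refine ((g y - g x).curryRight.le_opNorm u).trans ?_
    rw [ContinuousMultilinearMap.curryRight_norm]
    gcongr
  have key := (convex_ball x δ).norm_image_sub_le_of_norm_hasFDerivWithin_le'
    (fun y _ => (hderiv u y).hasFDerivWithinAt) hbound (Metric.mem_ball_self hδ)
    (show x + h ∈ Metric.ball x δ by simpa using hh)
  rw [add_sub_cancel_left] at key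
  refine key.trans_eq ?_
  ring
end
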